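/- arXiv:1001.2193 — 2 statements merged into one kernel-verified Lean document; each statement's English description precedes it below -/
import Mathlib

section
/- The only G-sets with no y-valley and no z-valley are Γ_x = {(m,0,0) : 0 ≤ m ≤ r−1} and, for each l with 0 ≤ l ≤ r−1, the set Γ_{yz,l} = {(0,n,0) : 0 ≤ n ≤ r−l−1} ∪ {(0,0,p) : 0 ≤ p ≤ l}; conversely each of these sets is a G-set with no valleys. -/
open scoped BigOperators Classical

namespace GH

/-- Exponent vectors of monomials `x^m y^n z^p`. -/
abbrev N3 : Type := ℕ × ℕ × ℕ

/-- The lattice `ℤ³`. -/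
abbrev Z3 : Type := ℤ × ℤ × ℤ

/-- Inclusion `ℕ³ → ℤ³`. -/
def toZ (v : N3) : Z3 := ((v.1 : ℤ), (v.2.1 : ℤ), (v.2.2 : ℤ))

/-- The weight map `wt(m,n,p) = m + a·n + (r−a)·p (mod r)` on `ℤ³`. -/
def wtZ (r a : ℕ) (v : Z3) : ZMod r :=
  (v.1 : ZMod r) + (a : ZMod r) * (v.2.1 : ZMod r) + ((r - a : ℕ) : ZMod r) * (v.2.2 : ZMod r)

/-- The weight map on `ℕ³`. -/
def wtN (r a : ℕ) (v : N3) : ZMod r := wtZ r a (toZ v)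

/-- A `G`-set: contains the origin, closed under taking summands, and the weight map
restricted to it is a bijection onto `ℤ/rℤ`. -/
structure IsGSet (r a : ℕ) (Γ : Set N3) : Prop where
  zero_mem : (0, 0, 0) ∈ Γ
  dclosed : ∀ u v : N3, u + v ∈ Γ → u ∈ Γ ∧ v ∈ Γ
  bij : Set.BijOn (wtN r a) Γ Set.univ

/-- `wt_Γ(v)`: the (unique, for a `G`-set) element of `Γ` of the same weight as `v`. -/
noncomputable def wtG (r a : ℕ) (Γ : Set N3) (v : N3) : N3 :=
  if h : ∃ w, w ∈ Γ ∧ wtN r a w = wtN r a v then h.choose else (0, 0, 0)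

/-- `(m,n)` is a y-valley of `Γ`. -/
def IsYValley (Γ : Set N3) (m n : ℕ) : Prop :=
  (m, n, 0) ∈ Γ ∧ (m + 1, n, 0) ∈ Γ ∧ (m, n + 1, 0) ∈ Γ ∧ (m + 1, n + 1, 0) ∉ Γ

/-- `(m,n)` is a z-valley of `Γ`. -/
def IsZValley (Γ : Set N3) (m n : ℕ) : Prop :=
  (m, 0, n) ∈ Γ ∧ (m + 1, 0, n) ∈ Γ ∧ (m, 0, n + 1) ∈ Γ ∧ (m + 1, 0, n + 1) ∉ Γ

/-- A primitive `G`-set: it has a y-valley `(i_y, 0)` and a z-valley `(i_z, 0)`. -/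
def IsPrimG (Γ : Set N3) : Prop := (∃ p : ℕ, IsYValley Γ p 0) ∧ (∃ p : ℕ, IsZValley Γ p 0)

/-- `s_Γ(v) = v − wt_Γ(v) ∈ ℤ³`. -/
noncomputable def sG (r a : ℕ) (Γ : Set N3) (v : N3) : Z3 := toZ v - toZ (wtG r a Γ v)

/-- The submonoid `S(Γ)` of `ℤ³` generated by all `s_Γ(v)`. -/
noncomputable def SMon (r a : ℕ) (Γ : Set N3) : AddSubmonoid Z3 :=
  AddSubmonoid.closure (Set.range (sG r a Γ))

/-- The lattice `M = { u ∈ ℤ³ : wt(u) = 0 }` of `G`-invariant monomials. -/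
def latM (r a : ℕ) : Set Z3 := { u | wtZ r a u = 0 }

/-- The standard pairing of `ℝ³` with `ℤ³`. -/
def dotR (α : ℝ × ℝ × ℝ) (u : Z3) : ℝ :=
  α.1 * (u.1 : ℝ) + α.2.1 * (u.2.1 : ℝ) + α.2.2 * (u.2.2 : ℝ)

/-- The cone `σ(Γ) = { α ∈ ℝ³ : ⟨α, s_Γ(v)⟩ ≥ 0 for all v ∈ ℕ³ }`. -/
noncomputable def sigmaCone (r a : ℕ) (Γ : Set N3) : Set (ℝ × ℝ × ℝ) :=
  { α | ∀ v : N3, 0 ≤ dotR α (sG r a Γ v) }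

/-- `span(u₁,…,u_t)`: all `v ∈ ℕ³` dominated componentwise by some `u_s`. -/
def spanSet (s : Set N3) : Set N3 := { v | ∃ u ∈ s, v ≤ u }

/-- `i(Γ)`: the largest `m` with `(m,0,0) ∈ Γ`. -/
noncomputable def iOf (Γ : Set N3) : ℕ := sSup { m : ℕ | (m, 0, 0) ∈ Γ }

/-- `j(Γ)`: the largest `n` with `(0,n,0) ∈ Γ`. -/
noncomputable def jOf (Γ : Set N3) : ℕ := sSup { n : ℕ | (0, n, 0) ∈ Γ }

/-- `k(Γ)`: the largest `p` with `(0,0,p) ∈ Γ`. -/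
noncomputable def kOf (Γ : Set N3) : ℕ := sSup { p : ℕ | (0, 0, p) ∈ Γ }

/-- `c(w) = max { c : w − c·v ∈ ℕ³ }` (componentwise). -/
noncomputable def cmax (v w : N3) : ℕ := sSup { c : ℕ | c • v ≤ w }

/-- The `G`-igsaw transformation of `Γ` in the direction of `u`:
`T_u(Γ) = { w + c(w)·(u − v) : w ∈ Γ }` where `v = wt_Γ(u)`. -/
noncomputable def jig (r a : ℕ) (Γ : Set N3) (u : N3) : Set N3 :=
  { w' | ∃ w ∈ Γ,
      toZ w' = toZ w + (cmax (wtG r a Γ u) w) • (toZ u - toZ (wtG r a Γ u)) }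

/-- The upper transformation `TU(Γ)`. -/
noncomputable def TU (r a : ℕ) (Γ : Set N3) : Set N3 := jig r a Γ (iOf Γ + 1, 0, 0)

/-- The right transformation `TR(Γ)`. -/
noncomputable def TR (r a : ℕ) (Γ : Set N3) : Set N3 := jig r a Γ (0, jOf Γ + 1, 0)

/-- The left transformation `TL(Γ)`. -/
noncomputable def TL (r a : ℕ) (Γ : Set N3) : Set N3 := jig r a Γ (0, 0, kOf Γ + 1)

/-- The y-valley of `Γ` (chosen by choice; unique for a `G`-set having one). -/
noncomputable def yValley (Γ : Set N3) : ℕ × ℕ :=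
  if h : ∃ p : ℕ × ℕ, IsYValley Γ p.1 p.2 then h.choose else (0, 0)

/-- The z-valley of `Γ` (chosen by choice; unique for a `G`-set having one). -/
noncomputable def zValley (Γ : Set N3) : ℕ × ℕ :=
  if h : ∃ p : ℕ × ℕ, IsZValley Γ p.1 p.2 then h.choose else (0, 0)

/-- The upper right transformation `TUR(Γ)`, in the direction `(i_y+1, j_y+1, 0)`. -/
noncomputable def TUR (r a : ℕ) (Γ : Set N3) : Set N3 :=
  jig r a Γ ((yValley Γ).1 + 1, (yValley Γ).2 + 1, 0)

/-- The upper left transformation `TUL(Γ)`, in the direction `(i_z+1, 0, k_z+1)`. -/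
noncomputable def TUL (r a : ℕ) (Γ : Set N3) : Set N3 :=
  jig r a Γ ((zValley Γ).1 + 1, 0, (zValley Γ).2 + 1)

/-- The bound `min{j, k, j − j_y, k − k_z}` for the triangle of transformations. -/
noncomputable def minBound (Γ : Set N3) : ℕ :=
  min (min (jOf Γ) (kOf Γ)) (min (jOf Γ - (yValley Γ).2) (kOf Γ - (zValley Γ).2))

/-- The triangle of transformations `Θ(Γ)`. -/
noncomputable def Theta (r a : ℕ) (Γ : Set N3) : Set (Set N3) :=
  { Γ' | ∃ p q : ℕ, p + q ≤ minBound Γ ∧ Γ' = (TUR r a)^[p] ((TUL r a)^[q] Γ) }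

/-- The recursion step producing `Γ_{n+1}` from `Γ_n`. -/
noncomputable def nextGamma (r a : ℕ) (Γ : Set N3) : Set N3 :=
  if jOf Γ < kOf Γ then TU r a ((TUR r a)^[jOf Γ] Γ)
  else TU r a ((TUL r a)^[kOf Γ] Γ)

/-- The sequence of primitive `G`-sets; `GammaSeq r a b (n-1)` is `Γ_n`,
starting from `Γ₁ = span((1,0,0),(0,b−1,0),(0,0,r−b−1))`. -/
noncomputable def GammaSeq (r a b : ℕ) : ℕ → Set N3
  | 0 => spanSet {(1, 0, 0), (0, b - 1, 0), (0, 0, r - b - 1)}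
  | n + 1 => nextGamma r a (GammaSeq r a b n)


section Weights

variable {r a : ℕ}

lemma wtN_apply (har : a ≤ r) (m n p : ℕ) :
    wtN r a (m, n, p) = (m : ZMod r) + a * ((n : ZMod r) - p) := by
  simp only [wtN, wtZ, toZ, Nat.cast_sub har, Int.cast_natCast, CharP.cast_eq_zero]
  ring

lemma isUnit_natCast_of_coprime (hra : Nat.Coprime r a) : IsUnit (a : ZMod r) :=
  (ZMod.isUnit_iff_coprime a r).2 hra.symm

end Weights

namespace IsGSet

variable {r a : ℕ} {Γ : Set N3}

lemma mem_of_le (h : IsGSet r a Γ) {m n p m' n' p' : ℕ} (hv : (m', n', p') ∈ Γ)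
    (hm : m ≤ m') (hn : n ≤ n') (hp : p ≤ p') : (m, n, p) ∈ Γ := by
  refine (h.dclosed (m, n, p) (m' - m, n' - n, p' - p) ?_).1
  simpa [hm, hn, hp] using hv

lemma exists_of_weight (h : IsGSet r a Γ) (har : a ≤ r) (w : ZMod r) :
    ∃ m n p : ℕ, (m, n, p) ∈ Γ ∧ (m : ZMod r) + a * ((n : ZMod r) - p) = w := by
  obtain ⟨⟨m, n, p⟩, hv, hw⟩ := h.bij.surjOn (Set.mem_univ w)
  exact ⟨m, n, p, hv, by rw [← wtN_apply har, hw]⟩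

lemma eq_of_weight (h : IsGSet r a Γ) (har : a ≤ r) {m n p m' n' p' : ℕ}
    (hv : (m, n, p) ∈ Γ) (hv' : (m', n', p') ∈ Γ)
    (hw : (m : ZMod r) + a * ((n : ZMod r) - p) = m' + a * ((n' : ZMod r) - p')) :
    m = m' ∧ n = n' ∧ p = p' := by
  simpa using h.bij.injOn hv hv' (by rw [wtN_apply har, wtN_apply har, hw])

/-- The monomial `y z` has weight zero, so no element of a `G`-set is divisible by it. -/
lemma y_eq_zero_or_z_eq_zero (h : IsGSet r a Γ) (har : a ≤ r) {m n p : ℕ}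
    (hv : (m, n, p) ∈ Γ) : n = 0 ∨ p = 0 := by
  by_contra! hnp
  have := h.eq_of_weight har
    (h.mem_of_le (m := 0) (n := 1) (p := 1) hv (by lia) (by lia) (by lia)) h.zero_mem (by simp)
  lia

lemma mem_xy_of_no_yValley (h : IsGSet r a Γ) (hy : ∀ m n, ¬ IsYValley Γ m n) {n : ℕ}
    (hn : (0, n, 0) ∈ Γ) {m : ℕ} (hm : (m, 0, 0) ∈ Γ) : (m, n, 0) ∈ Γ := by
  induction n generalizing m with
  | zero => exact hm
  | succ n ihn =>
    induction m with
    | zero => exact hn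
    | succ m ihm =>
      have hn' := h.mem_of_le (m := 0) (n := n) (p := 0) hn le_rfl (by lia) le_rfl
      have hm' := h.mem_of_le (m := m) (n := 0) (p := 0) hm (by lia) le_rfl le_rfl
      by_contra hmn
      exact hy m n ⟨ihn hn' hm', ihn hn' hm, ihm hm', hmn⟩

lemma mem_xz_of_no_zValley (h : IsGSet r a Γ) (hz : ∀ m n, ¬ IsZValley Γ m n) {p : ℕ}
    (hp : (0, 0, p) ∈ Γ) {m : ℕ} (hm : (m, 0, 0) ∈ Γ) : (m, 0, p) ∈ Γ := by
  induction p generalizing m with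
  | zero => exact hm
  | succ p ihp =>
    induction m with
    | zero => exact hp
    | succ m ihm =>
      have hp' := h.mem_of_le (m := 0) (n := 0) (p := p) hp le_rfl le_rfl (by lia)
      have hm' := h.mem_of_le (m := m) (n := 0) (p := 0) hm (by lia) le_rfl le_rfl
      by_contra hmp
      exact hz m p ⟨ihp hp' hm', ihp hp' hm, ihm hm', hmp⟩

lemma mem_of_no_valley (h : IsGSet r a Γ) (har : a ≤ r) (hy : ∀ m n, ¬ IsYValley Γ m n)
    (hz : ∀ m n, ¬ IsZValley Γ m n) {m m' n p : ℕ} (hm : (m, 0, 0) ∈ Γ)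
    (hv : (m', n, p) ∈ Γ) : (m, n, p) ∈ Γ := by
  have hv₀ := h.mem_of_le (m := 0) hv (by lia) le_rfl le_rfl
  rcases h.y_eq_zero_or_z_eq_zero har hv with rfl | rfl
  · exact h.mem_xz_of_no_zValley hz hv₀ hm
  · exact h.mem_xy_of_no_yValley hy hv₀ hm

lemma exists_least_x_notMem (h : IsGSet r a Γ) (har : a ≤ r) (hr : 0 < r) :
    ∃ N, 0 < N ∧ N ≤ r ∧ ∀ m, (m, 0, 0) ∈ Γ ↔ m < N := by
  have hnot : (r, 0, 0) ∉ Γ := fun hmem => by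
    have := h.eq_of_weight har hmem h.zero_mem (by simp)
    lia
  have hex : ∃ m, (m, 0, 0) ∉ Γ := ⟨r, hnot⟩
  refine ⟨Nat.find hex, ?_, Nat.find_min' hex hnot, fun m => ?_⟩
  · rw [Nat.find_pos]
    exact not_not.2 h.zero_mem
  · refine ⟨fun hm => ?_, fun hm => not_not.1 (Nat.find_min hex hm)⟩
    by_contra! hle
    exact Nat.find_spec hex (h.mem_of_le hm hle le_rfl le_rfl)

/-- If a `G`-set has no valleys and contains exactly the powers of `x` below `N`, then the element
of weight `t` has `x`-exponent `t % N`. -/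
lemma exists_of_natCast_weight (h : IsGSet r a Γ) (har : a ≤ r) (hy : ∀ m n, ¬ IsYValley Γ m n)
    (hz : ∀ m n, ¬ IsZValley Γ m n) {N : ℕ} (hN : 0 < N) (hx : ∀ m, (m, 0, 0) ∈ Γ ↔ m < N)
    (t : ℕ) :
    ∃ n p : ℕ, (t % N, n, p) ∈ Γ ∧ ((t % N : ℕ) : ZMod r) + a * ((n : ZMod r) - p) = t := by
  induction t with
  | zero => exact ⟨0, 0, by simpa using h.zero_mem, by simp⟩
  | succ t ih =>
    obtain ⟨n, p, hv, hw⟩ := ih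
    have hlt := Nat.mod_lt t hN
    rcases Nat.lt_or_ge (t % N + 1) N with hlt' | hge
    · have hmod : (t + 1) % N = t % N + 1 := by
        rw [Nat.add_mod_eq_ite, Nat.mod_eq_of_lt (show 1 < N by lia), if_neg (by lia)]
      rw [hmod]
      refine ⟨n, p, h.mem_of_no_valley har hy hz ((hx _).2 hlt') hv, ?_⟩
      push_cast
      rw [← hw]
      ring
    · have hmod : (t + 1) % N = 0 := by
        rw [← Nat.mod_add_mod, show t % N + 1 = N by lia, Nat.mod_self]
      obtain ⟨m', n', p', hv', hw'⟩ := h.exists_of_weight har ((t + 1 : ℕ) : ZMod r)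
      rcases m' with _ | m'
      · exact ⟨n', p', by rwa [hmod], by rw [hmod, hw']⟩
      · have hv'' := h.mem_of_le (m := m') hv' (by lia) le_rfl le_rfl
        have := h.eq_of_weight har hv'' hv (by rw [hw]; push_cast at hw'; linear_combination hw')
        have hm' := (hx _).1 (h.mem_of_le (m := m' + 1) (n := 0) (p := 0) hv' le_rfl
          (by lia) (by lia))
        lia

/-- A `G`-set without valleys lies on the `x`-axis or in the plane `x = 0`. -/
lemma x_notMem_or_yz_notMem (h : IsGSet r a Γ) (hra : Nat.Coprime r a) (har : a ≤ r)
    (hr : 0 < r) (hy : ∀ m n, ¬ IsYValley Γ m n) (hz : ∀ m n, ¬ IsZValley Γ m n) :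
    (1, 0, 0) ∉ Γ ∨ (0, 1, 0) ∉ Γ ∧ (0, 0, 1) ∉ Γ := by
  obtain ⟨N, hN, -, hx⟩ := h.exists_least_x_notMem har hr
  have dvd_of_mem : ∀ {n p t : ℕ}, (0, n, p) ∈ Γ → (a : ZMod r) * ((n : ZMod r) - p) = t →
      N ∣ t := by
    intro n p t hv hw
    obtain ⟨n', p', hv', hw'⟩ := h.exists_of_natCast_weight har hy hz hN hx t
    exact Nat.dvd_of_mod_eq_zero (h.eq_of_weight har hv' hv (by rw [hw', ← hw]; simp)).1
  have hNr : N ∣ r := dvd_of_mem h.zero_mem (by simp)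
  by_contra! hcon
  obtain ⟨h1, h2⟩ := hcon
  have hNa : N ∣ a := by
    by_cases hy1 : (0, 1, 0) ∈ Γ
    · exact dvd_of_mem hy1 (by simp)
    · have := dvd_of_mem (t := r - a) (h2 hy1) (by simp [Nat.cast_sub har])
      exact (Nat.dvd_sub_iff_right har hNr).1 this
  have hN1 := Nat.eq_one_of_dvd_coprimes hra hNr hNa
  have := (hx 1).1 h1
  lia

lemma eq_x_axis (h : IsGSet r a Γ) (har : a ≤ r) (hr : 0 < r)
    (hy : (0, 1, 0) ∉ Γ) (hz : (0, 0, 1) ∉ Γ) :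
    Γ = {v : N3 | ∃ m : ℕ, m ≤ r - 1 ∧ v = (m, 0, 0)} := by
  have hyz : ∀ {m n p : ℕ}, (m, n, p) ∈ Γ → n = 0 ∧ p = 0 := by
    intro m n p hv
    constructor <;> by_contra hne
    · exact hy (h.mem_of_le hv (by lia) (by lia) (by lia))
    · exact hz (h.mem_of_le hv (by lia) (by lia) (by lia))
  obtain ⟨N, -, hNr, hx⟩ := h.exists_least_x_notMem har hr
  have hrN : r - 1 < N := by
    obtain ⟨m, n, p, hv, hw⟩ := h.exists_of_weight har ((r - 1 : ℕ) : ZMod r)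
    obtain ⟨rfl, rfl⟩ := hyz hv
    have hm := (hx m).1 hv
    rw [Nat.cast_zero, sub_self, mul_zero, add_zero, ZMod.natCast_eq_natCast_iff'] at hw
    rw [Nat.mod_eq_of_lt (by lia), Nat.mod_eq_of_lt (by lia)] at hw
    lia
  ext ⟨m, n, p⟩
  constructor
  · intro hv
    obtain ⟨rfl, rfl⟩ := hyz hv
    have := (hx m).1 hv
    exact ⟨m, by lia, rfl⟩
  · rintro ⟨m', hm', hv⟩
    rw [hv, hx]
    lia

lemma exists_eq_yz (h : IsGSet r a Γ) (hra : Nat.Coprime r a) (har : a ≤ r) (hr : 0 < r)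
    (hx : (1, 0, 0) ∉ Γ) :
    ∃ l : ℕ, l ≤ r - 1 ∧
      Γ = {v : N3 | ∃ n : ℕ, n ≤ r - l - 1 ∧ v = (0, n, 0)} ∪
          {v : N3 | ∃ p : ℕ, p ≤ l ∧ v = (0, 0, p)} := by
  have hx0 : ∀ {m n p : ℕ}, (m, n, p) ∈ Γ → m = 0 := by
    intro m n p hv
    by_contra hne
    exact hx (h.mem_of_le hv (by lia) (by lia) (by lia))
  have hnot : (0, 0, r) ∉ Γ := fun hmem => by
    have := h.eq_of_weight har hmem h.zero_mem (by simp)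
    lia
  have hex : ∃ p, (0, 0, p + 1) ∉ Γ := ⟨r - 1, by rwa [Nat.sub_add_cancel hr]⟩
  obtain ⟨l, hl, hlmin⟩ : ∃ l, (0, 0, l + 1) ∉ Γ ∧ ∀ p < l, (0, 0, p + 1) ∈ Γ :=
    ⟨Nat.find hex, Nat.find_spec hex, fun p hp => not_not.1 (Nat.find_min hex hp)⟩
  have hlmem : (0, 0, l) ∈ Γ := by
    rcases l with _ | l
    · exact h.zero_mem
    · exact hlmin l (by lia)
  have hlr : l < r := by
    by_contra! hle
    exact hnot (h.mem_of_le hlmem le_rfl le_rfl hle)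
  have hymax : (0, r - l, 0) ∉ Γ := fun hmem => by
    have := h.eq_of_weight har hmem hlmem (by simp [Nat.cast_sub hlr.le])
    lia
  have hymem : (0, r - l - 1, 0) ∈ Γ := by
    obtain ⟨m, n, p, hv, hw⟩ := h.exists_of_weight har ((a : ZMod r) * (0 - (l + 1 : ℕ)))
    obtain rfl := hx0 hv
    rw [Nat.cast_zero, zero_add] at hw
    have hw' := (isUnit_natCast_of_coprime hra).mul_left_cancel hw
    have hp : p ≤ l := by
      by_contra! hlt
      exact hl (h.mem_of_le hv le_rfl (by lia) hlt)
    have hdvd : r ∣ n + (l + 1 - p) := by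
      rw [← ZMod.natCast_eq_zero_iff, Nat.cast_add, Nat.cast_sub (by lia)]
      linear_combination hw'
    have hle := Nat.le_of_dvd (by lia) hdvd
    exact h.mem_of_le hv le_rfl (by lia) (by lia)
  refine ⟨l, by lia, ?_⟩
  ext ⟨m, n, p⟩
  constructor
  · intro hv
    obtain rfl := hx0 hv
    rcases h.y_eq_zero_or_z_eq_zero har hv with rfl | rfl
    · refine Or.inr ⟨p, ?_, rfl⟩
      by_contra! hlt
      exact hl (h.mem_of_le hv le_rfl le_rfl hlt)
    · refine Or.inl ⟨n, ?_, rfl⟩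
      by_contra! hlt
      exact hymax (h.mem_of_le hv le_rfl (by lia) le_rfl)
  · rintro (⟨n', hn', hv⟩ | ⟨p', hp', hv⟩) <;> rw [hv]
    · exact h.mem_of_le hymem le_rfl hn' le_rfl
    · exact h.mem_of_le hlmem le_rfl le_rfl hp'

end IsGSet

lemma isGSet_x_axis {r a : ℕ} (har : a ≤ r) (hr : 0 < r) :
    IsGSet r a {v : N3 | ∃ m : ℕ, m ≤ r - 1 ∧ v = (m, 0, 0)} where
  zero_mem := ⟨0, by lia, rfl⟩
  dclosed := by
    rintro ⟨m, n, p⟩ ⟨m', n', p'⟩ ⟨k, hk, hv⟩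
    simp only [Prod.mk_add_mk, Prod.mk.injEq] at hv
    exact ⟨⟨m, by lia, by simp; lia⟩, ⟨m', by lia, by simp; lia⟩⟩
  bij := by
    have : NeZero r := ⟨hr.ne'⟩
    refine ⟨fun _ _ => Set.mem_univ _, ?_, ?_⟩
    · rintro _ ⟨m, hm, rfl⟩ _ ⟨m', hm', rfl⟩ hw
      rw [wtN_apply har, wtN_apply har, add_left_inj, ZMod.natCast_eq_natCast_iff',
        Nat.mod_eq_of_lt (by lia), Nat.mod_eq_of_lt (by lia)] at hw
      rw [hw]
    · intro w _
      refine ⟨(w.val, 0, 0), ⟨w.val, Nat.le_sub_one_of_lt w.val_lt, rfl⟩, ?_⟩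
      simp [wtN_apply har]

lemma isGSet_yz {r a l : ℕ} (hra : Nat.Coprime r a) (har : a ≤ r) (hr : 0 < r)
    (hl : l ≤ r - 1) :
    IsGSet r a ({v : N3 | ∃ n : ℕ, n ≤ r - l - 1 ∧ v = (0, n, 0)} ∪
      {v : N3 | ∃ p : ℕ, p ≤ l ∧ v = (0, 0, p)}) where
  zero_mem := Or.inl ⟨0, by lia, rfl⟩
  dclosed := by
    rintro ⟨m, n, p⟩ ⟨m', n', p'⟩ (⟨k, hk, hv⟩ | ⟨k, hk, hv⟩) <;>
      simp only [Prod.mk_add_mk, Prod.mk.injEq] at hv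
    · exact ⟨Or.inl ⟨n, by lia, by simp; lia⟩, Or.inl ⟨n', by lia, by simp; lia⟩⟩
    · exact ⟨Or.inr ⟨p, by lia, by simp; lia⟩, Or.inr ⟨p', by lia, by simp; lia⟩⟩
  bij := by
    have : NeZero r := ⟨hr.ne'⟩
    have ha := isUnit_natCast_of_coprime hra
    refine ⟨fun _ _ => Set.mem_univ _, ?_, ?_⟩
    · have key : ∀ {n p n' p' : ℕ}, n ≤ r - l - 1 → n' ≤ r - l - 1 → p ≤ l → p' ≤ l →
          wtN r a (0, n, p) = wtN r a (0, n', p') → n + p' = n' + p := by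
        intro n p n' p' hn hn' hp hp' hw
        rw [wtN_apply har, wtN_apply har, add_right_inj] at hw
        have hw' := ha.mul_left_cancel hw
        have hcast : ((n + p' : ℕ) : ZMod r) = (n' + p : ℕ) := by
          push_cast
          linear_combination hw'
        rwa [ZMod.natCast_eq_natCast_iff', Nat.mod_eq_of_lt (by lia),
          Nat.mod_eq_of_lt (by lia)] at hcast
      rintro _ (⟨n, hn, rfl⟩ | ⟨n, hn, rfl⟩) _ (⟨n', hn', rfl⟩ | ⟨n', hn', rfl⟩) hw <;>
        have := key (by lia) (by lia) (by lia) (by lia) hw <;> simp <;> lia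
    · intro w _
      obtain ⟨u, rfl⟩ : ∃ u : ZMod r, a * u = w := ha.dvd.imp fun _ => Eq.symm
      have hu := u.val_lt
      rcases Nat.lt_or_ge (r - l - 1) u.val with hlt | hle
      · refine ⟨(0, 0, r - u.val), Or.inr ⟨r - u.val, by lia, rfl⟩, ?_⟩
        simp [wtN_apply har, Nat.cast_sub hu.le]
      · refine ⟨(0, u.val, 0), Or.inl ⟨u.val, hle, rfl⟩, ?_⟩
        simp [wtN_apply har]

/-- The `G`-sets with no valleys are exactly `Γ_x` and the `Γ_{yz,l}`. -/
theorem stmt1 (r a : ℕ) (hra : Nat.Coprime r a) (ha2 : 2 ≤ a) (halt : a < r - a) (Γ : Set N3) :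
    (IsGSet r a Γ ∧ (∀ m n : ℕ, ¬ IsYValley Γ m n) ∧ (∀ m n : ℕ, ¬ IsZValley Γ m n)) ↔
      (Γ = {v : N3 | ∃ m : ℕ, m ≤ r - 1 ∧ v = (m, 0, 0)} ∨
        ∃ l : ℕ, l ≤ r - 1 ∧
          Γ = {v : N3 | ∃ n : ℕ, n ≤ r - l - 1 ∧ v = (0, n, 0)} ∪
              {v : N3 | ∃ p : ℕ, p ≤ l ∧ v = (0, 0, p)}) := by
  have har : a ≤ r := by lia
  have hr : 0 < r := by lia
  constructor
  · rintro ⟨h, hy, hz⟩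
    rcases h.x_notMem_or_yz_notMem hra har hr hy hz with hx | ⟨hy1, hz1⟩
    · exact Or.inr (h.exists_eq_yz hra har hr hx)
    · exact Or.inl (h.eq_x_axis har hr hy1 hz1)
  · rintro (rfl | ⟨l, hl, rfl⟩)
    · refine ⟨isGSet_x_axis har hr, ?_, ?_⟩
      · rintro m n ⟨-, -, ⟨k, -, hk⟩, -⟩
        simp at hk
      · rintro m n ⟨-, -, ⟨k, -, hk⟩, -⟩
        simp at hk
    · refine ⟨isGSet_yz hra har hr hl, ?_, ?_⟩
      · rintro m n ⟨-, ⟨k, -, hk⟩ | ⟨k, -, hk⟩, -, -⟩ <;> simp at hk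
      · rintro m n ⟨-, ⟨k, -, hk⟩ | ⟨k, -, hk⟩, -, -⟩ <;> simp at hk

end GH
end

section
/- Let Γ be a G-set with exactly one valley, and write i = i(Γ), j = j(Γ), k = k(Γ). If the unique valley is a z-valley (i_z,k_z), then wt_Γ((i+1,0,0)) = (0,0,k−k_z) and wt_Γ((0,0,k+1)) = (i−i_z, j, 0). If the unique valley is a y-valley (i_y,j_y), then wt_Γ((i+1,0,0)) = (0,j−j_y,0) and wt_Γ((0,j+1,0)) = (i−i_y, 0, k). -/
open scoped BigOperators Classical

namespace GH

/-- A relation on a rectangle which holds on the two axes and is closed under filling in the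
upper right corner of a unit square holds on the whole rectangle. -/
theorem rect_fill (Q : ℕ → ℕ → Prop) (M N : ℕ) (hx : ∀ m ≤ M, Q m 0) (hy : ∀ n ≤ N, Q 0 n)
    (hs : ∀ m n, m < M → n < N → Q m n → Q (m + 1) n → Q m (n + 1) → Q (m + 1) (n + 1)) :
    ∀ m n, m ≤ M → n ≤ N → Q m n := by
  intro m
  induction m with
  | zero => exact fun n _ hn => hy n hn
  | succ m ihm =>
    intro n
    induction n with
    | zero => exact fun hm _ => hx _ hm
    | succ n ihn =>
      intro hm hn
      exact hs m n (by omega) (by omega) (ihm n (by omega) (by omega)) (ihn hm (by omega))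
        (ihm (n + 1) (by omega) hn)

/-- If a down-closed set of exponents is mapped bijectively onto `ℤ/rℤ` by
`(m, n, p) ↦ m + A n - A p`, its `(m, n)`-plane is a rectangle and its `(m, p)`-plane has the
single valley `(iz, kz)`, then `(i + 1, 0, 0)` and `(0, 0, k + 1)` have the stated weights. -/
theorem weights_of_single_valley {r : ℕ} [NeZero r] (A B : ZMod r) (hAB : A * B = 1)
    (P : ℕ → ℕ → ℕ → Prop) (hdown : ∀ {m n p m' n' p' : ℕ}, P m n p → m' ≤ m → n' ≤ n →
      p' ≤ p → P m' n' p')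
    (hinj : ∀ {m n p m' n' p' : ℕ}, P m n p → P m' n' p' →
      (m : ZMod r) + A * n - A * p = m' + A * n' - A * p' → m = m' ∧ n = n' ∧ p = p')
    (hsurj : ∀ x : ZMod r, ∃ m n p : ℕ, P m n p ∧ (m : ZMod r) + A * n - A * p = x)
    {i j k iz kz : ℕ} (hi : P i 0 0) (hi' : ¬ P (i + 1) 0 0) (hj : P 0 j 0)
    (hj' : ¬ P 0 (j + 1) 0) (hk : P 0 0 k) (hk' : ¬ P 0 0 (k + 1))
    (hv₁ : P (iz + 1) 0 kz) (hv₂ : P iz 0 (kz + 1)) (hv₃ : ¬ P (iz + 1) 0 (kz + 1))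
    (huniq : ∀ m n, P m 0 n → P (m + 1) 0 n → P m 0 (n + 1) → ¬ P (m + 1) 0 (n + 1) →
      m = iz ∧ n = kz)
    (hno : ∀ m n, P m n 0 → P (m + 1) n 0 → P m (n + 1) 0 → P (m + 1) (n + 1) 0) :
    (P 0 0 (k - kz) ∧ ((i + 1 : ℕ) : ZMod r) = - A * ((k - kz : ℕ) : ZMod r)) ∧
    (P (i - iz) j 0 ∧ - A * ((k + 1 : ℕ) : ZMod r) = ((i - iz : ℕ) : ZMod r) + A * j) := by
  have hzero : P 0 0 0 := hdown hi (by omega) le_rfl le_rfl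
  have hle_i : ∀ {m n p}, P m n p → m ≤ i := fun {m n p} h => by
    by_contra hc
    exact hi' (hdown h (by omega) (by omega) (by omega))
  have hle_j : ∀ {m n p}, P m n p → n ≤ j := fun {m n p} h => by
    by_contra hc
    exact hj' (hdown h (by omega) (by omega) (by omega))
  have hle_k : ∀ {m n p}, P m n p → p ≤ k := fun {m n p} h => by
    by_contra hc
    exact hk' (hdown h (by omega) (by omega) (by omega))
  have hplane : ∀ {m n p}, P m n p → n = 0 ∨ p = 0 := fun {m n p} h => by
    by_contra! hc
    have h1 : P 0 1 1 := hdown h (by omega) (by omega) (by omega)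
    have := hinj h1 hzero (by push_cast; ring)
    omega
  have hiz : iz + 1 ≤ i := hle_i hv₁
  have hkz : kz + 1 ≤ k := hle_k hv₂
  have hrect : ∀ m n, m ≤ i → n ≤ j → P m n 0 :=
    rect_fill (fun m n => P m n 0) i j (fun m hm => hdown hi hm le_rfl le_rfl)
      (fun n hn => hdown hj le_rfl hn le_rfl) (fun m n _ _ => hno m n)
  have hlow : ∀ m n, m ≤ i → n ≤ kz → P m 0 n :=
    rect_fill (fun m n => P m 0 n) i kz (fun m hm => hdown hi hm le_rfl le_rfl)
      (fun n hn => hdown hk le_rfl le_rfl (by omega)) (fun m n _ hn h1 h2 h3 => by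
        by_contra hc
        have := huniq m n h1 h2 h3 hc
        omega)
  have hleft : ∀ m n, m ≤ iz → n ≤ k → P m 0 n :=
    rect_fill (fun m n => P m 0 n) iz k (fun m hm => hdown hi (by omega) le_rfl le_rfl)
      (fun n hn => hdown hk le_rfl le_rfl hn) (fun m n hm _ h1 h2 h3 => by
        by_contra hc
        have := huniq m n h1 h2 h3 hc
        omega)
  have hcorner : ∀ {m n p}, P m n p → iz < m → p ≤ kz := fun {m n p} h hm => by
    by_contra hc
    exact hv₃ (hdown h (by omega) (by omega) (by omega))
  have hx_order : ((i + 1 : ℕ) : ZMod r) ≠ 0 := fun h => by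
    have hr : r ≤ i + 1 := Nat.le_of_dvd (by omega) ((ZMod.natCast_eq_zero_iff _ _).1 h)
    have hval := ZMod.val_lt (-A)
    have := hinj (hdown hi (by omega : (-A).val ≤ i) le_rfl le_rfl)
      (hleft 0 1 (by omega) (by omega)) (by simp)
    omega
  have hyz_order : A * ((j + 1 + k : ℕ) : ZMod r) ≠ 0 := fun h => by
    have h0 : ((j + 1 + k : ℕ) : ZMod r) = 0 := by 
      linear_combination B * h - hAB * ((j + 1 + k : ℕ) : ZMod r)
    have hr : r ≤ j + 1 + k := Nat.le_of_dvd (by omega) ((ZMod.natCast_eq_zero_iff _ _).1 h0)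
    have hval := ZMod.val_lt B
    have h1 : P 1 0 0 := hrect 1 0 (by omega) (by omega)
    by_cases hBj : B.val ≤ j
    · have := hinj (hrect 0 B.val (by omega) hBj) h1 (by simp [hAB])
      omega
    · have := hinj (hleft 0 (r - B.val) (by omega) (by omega)) h1
        (by simp [Nat.cast_sub hval.le, hAB])
      omega
  obtain ⟨m, n, p, hP, hw⟩ := hsurj (A * ((j + 1 : ℕ) : ZMod r))
  push_cast at hw
  obtain rfl : n = 0 := by
    rcases n with _ | n
    · rfl
    · have := hinj (hdown hP le_rfl (Nat.le_succ n) le_rfl) hj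
        (by push_cast at hw ⊢; linear_combination hw)
      obtain ⟨rfl, rfl, rfl⟩ := this
      exact absurd hP hj'
  have htop : ¬ P m 0 (p + 1) := fun h => by
    have := hinj h hj (by push_cast at hw ⊢; linear_combination hw)
    omega
  have hpk := hle_k hP
  have hmi := hle_i hP
  have hm_cases : m = 0 ∨ m = iz + 1 := by
    by_contra! hm
    obtain ⟨m, rfl⟩ := Nat.exists_eq_succ_of_ne_zero hm.1
    simp only [Nat.succ_eq_add_one] at *
    have hP₀ : P m 0 p := hdown hP (by omega) le_rfl le_rfl
    have htop₀ : ¬ P m 0 (p + 1) := fun h => by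
      rcases Nat.lt_or_ge iz m with hlt | hge
      · exact htop (hlow _ _ hmi (hcorner h hlt))
      · exact htop (hleft _ _ (by omega) (hle_k h))
    obtain ⟨c, d, e, hv, hvw⟩ := hsurj ((m : ZMod r) - A * ((p + 1 : ℕ) : ZMod r))
    push_cast at hvw hw
    have he : e = 0 := by
      rcases e with _ | e
      · rfl
      · have := hinj (hdown hv le_rfl le_rfl (Nat.le_succ e)) hP₀
          (by push_cast at hvw ⊢; linear_combination hvw)
        obtain ⟨rfl, rfl, rfl⟩ := this
        exact absurd hv htop₀
    subst he
    have hci := hle_i hv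
    have hdj := hle_j hv
    obtain rfl : d = j := by
      by_contra hne
      have := hinj (hrect c (d + 1) hci (by omega)) hP₀
        (by push_cast at hvw ⊢; linear_combination hvw)
      omega
    obtain rfl : c = i := by
      by_contra hne
      have := hinj (hrect (c + 1) d (by omega) le_rfl) hj
        (by push_cast at hvw ⊢; linear_combination hvw + hw)
      omega
    exact hx_order (by push_cast at hvw ⊢; linear_combination hvw + hw)
  have hy_top : A * ((j : ZMod r) + 1) = iz + 1 - A * kz := by
    rcases hm_cases with rfl | rfl
    · obtain rfl : p = k := by
        by_contra hne
        exact htop (hleft 0 (p + 1) (by omega) (by omega))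
      exact absurd (by push_cast at hw ⊢; linear_combination -hw) hyz_order
    · obtain rfl : p = kz := by
        have := hcorner hP (by omega)
        by_contra hne
        exact htop (hlow _ _ hmi (by omega))
      push_cast at hw
      linear_combination -hw
  obtain ⟨c, d, e, hv, hvw⟩ := hsurj (-A * ((k + 1 : ℕ) : ZMod r))
  push_cast at hvw
  obtain rfl : e = 0 := by
    rcases e with _ | e
    · rfl
    · have := hinj (hdown hv le_rfl le_rfl (Nat.le_succ e)) hk
        (by push_cast at hvw ⊢; linear_combination hvw)
      obtain ⟨rfl, rfl, rfl⟩ := this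
      exact absurd hv hk'
  have hci := hle_i hv
  have hdj := hle_j hv
  obtain rfl : d = j := by
    by_contra hne
    have := hinj (hrect c (d + 1) hci (by omega)) hk
      (by push_cast at hvw ⊢; linear_combination hvw)
    omega
  have hc : i ≤ c + iz := by
    by_contra hlt
    have := hinj (hlow (c + iz + 1) kz (by omega) le_rfl) hk
      (by push_cast at hvw ⊢; linear_combination hvw - hy_top)
    omega
  obtain ⟨e, he⟩ := Nat.exists_eq_add_of_le hc
  obtain ⟨f, g, h, hD, hDw⟩ := hsurj ((i + 1 : ℕ) : ZMod r)
  push_cast at hDw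
  obtain rfl : f = 0 := by
    rcases f with _ | f
    · rfl
    · have := hinj (hdown hD (Nat.le_succ f) le_rfl le_rfl) hi
        (by push_cast at hDw ⊢; linear_combination hDw)
      obtain ⟨rfl, rfl, rfl⟩ := this
      exact absurd hD hi'
  have hsum : P e g h := by
    rcases hplane hD with rfl | rfl
    · exact hleft e h (by omega) (hle_k hD)
    · exact hrect e g (by omega) (hle_j hD)
  have hcast : (c : ZMod r) + iz = i + e := by exact_mod_cast congrArg (Nat.cast (R := ZMod r)) he
  have hkk : P 0 0 (k - kz) := hdown hk le_rfl le_rfl (by omega)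
  obtain ⟨rfl, rfl, rfl⟩ := hinj hsum hkk (by
    rw [Nat.cast_sub (by omega)]
    push_cast at hDw hvw ⊢
    linear_combination hDw + hvw - hy_top - hcast)
  obtain rfl : c = i - iz := by omega
  refine ⟨⟨hD, ?_⟩, hv, ?_⟩
  · push_cast at hDw ⊢
    linear_combination -hDw
  · push_cast at hvw ⊢
    linear_combination -hvw

/-- The weight map on `ℕ³`, with `r - a` written as `-a`. -/
theorem wtN_eq {r a : ℕ} (h : a ≤ r) (m n p : ℕ) :
    wtN r a (m, n, p) = (m : ZMod r) + a * n - a * p := by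
  simp [wtN, wtZ, toZ, Nat.cast_sub h]
  ring

/-- An element of a `G`-set is the representative of every vector of the same weight. -/
theorem wtG_eq {r a : ℕ} {Γ : Set N3} (hΓ : IsGSet r a Γ) {v w : N3} (hw : w ∈ Γ)
    (h : wtN r a w = wtN r a v) : wtG r a Γ v = w := by
  have hex : ∃ w, w ∈ Γ ∧ wtN r a w = wtN r a v := ⟨w, hw, h⟩
  rw [wtG, dif_pos hex]
  exact hΓ.bij.injOn hex.choose_spec.1 hw (hex.choose_spec.2.trans h.symm)

/-- A `G`-set is closed under componentwise smaller vectors. -/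
theorem IsGSet.mem_of_le_s3 {r a : ℕ} {Γ : Set N3} (hΓ : IsGSet r a Γ) {v w : N3} (hw : w ∈ Γ)
    (h : v ≤ w) : v ∈ Γ :=
  (hΓ.dclosed v (w - v) (by rwa [add_tsub_cancel_of_le h])).1

/-- Extremes in the case of exactly one valley. -/
theorem stmt3 (r a : ℕ) (hra : Nat.Coprime r a) (ha2 : 2 ≤ a) (halt : a < r - a) (Γ : Set N3) (hΓ : IsGSet r a Γ)
    (i j k : ℕ)
    (hi : (i, 0, 0) ∈ Γ ∧ (i + 1, 0, 0) ∉ Γ)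
    (hj : (0, j, 0) ∈ Γ ∧ (0, j + 1, 0) ∉ Γ)
    (hk : (0, 0, k) ∈ Γ ∧ (0, 0, k + 1) ∉ Γ) :
    (∀ iz kz : ℕ, IsZValley Γ iz kz →
      (∀ m n : ℕ, IsZValley Γ m n → (m, n) = (iz, kz)) →
      (∀ m n : ℕ, ¬ IsYValley Γ m n) →
      wtG r a Γ (i + 1, 0, 0) = (0, 0, k - kz) ∧
      wtG r a Γ (0, 0, k + 1) = (i - iz, j, 0)) ∧
    (∀ iy jy : ℕ, IsYValley Γ iy jy →
      (∀ m n : ℕ, IsYValley Γ m n → (m, n) = (iy, jy)) →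
      (∀ m n : ℕ, ¬ IsZValley Γ m n) →
      wtG r a Γ (i + 1, 0, 0) = (0, j - jy, 0) ∧
      wtG r a Γ (0, j + 1, 0) = (i - iy, 0, k)) := by
  have har : a ≤ r := by omega
  have : NeZero r := ⟨by omega⟩
  have hAB : (a : ZMod r) * (a : ZMod r)⁻¹ = 1 := ZMod.coe_mul_inv_eq_one a hra.symm
  have hinj : ∀ {m n p m' n' p' : ℕ}, (m, n, p) ∈ Γ → (m', n', p') ∈ Γ →
      (m : ZMod r) + a * n - a * p = m' + a * n' - a * p' → m = m' ∧ n = n' ∧ p = p' := by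
    intro m n p m' n' p' h h' hw
    simpa using hΓ.bij.injOn h h' (by rw [wtN_eq har, wtN_eq har, hw])
  have hsurj : ∀ x : ZMod r, ∃ m n p : ℕ, (m, n, p) ∈ Γ ∧ (m : ZMod r) + a * n - a * p = x := by
    intro x
    obtain ⟨⟨m, n, p⟩, hm, hx⟩ := hΓ.bij.surjOn (Set.mem_univ x)
    exact ⟨m, n, p, hm, by rw [← hx, wtN_eq har]⟩
  constructor
  · intro iz kz hv huniq hno
    obtain ⟨⟨h1, h2⟩, h3, h4⟩ := weights_of_single_valley (a : ZMod r) _ hAB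
      (fun m n p => (m, n, p) ∈ Γ)
      (fun h hm hn hp => hΓ.mem_of_le_s3 h ⟨hm, hn, hp⟩) hinj hsurj hi.1 hi.2 hj.1 hj.2 hk.1 hk.2
      hv.2.1 hv.2.2.1 hv.2.2.2
      (fun m n q1 q2 q3 q4 => by simpa using huniq m n ⟨q1, q2, q3, q4⟩)
      (fun m n q1 q2 q3 => by
        by_contra q4
        exact hno m n ⟨q1, q2, q3, q4⟩)
    refine ⟨wtG_eq hΓ h1 ?_, wtG_eq hΓ h3 ?_⟩
    · rw [wtN_eq har, wtN_eq har]
      linear_combination -h2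
    · rw [wtN_eq har, wtN_eq har]
      linear_combination -h4
  · intro iy jy hv huniq hno
    obtain ⟨⟨h1, h2⟩, h3, h4⟩ := weights_of_single_valley (-a : ZMod r) (-(a : ZMod r)⁻¹)
      (by rw [neg_mul_neg, hAB]) (fun m n p => (m, p, n) ∈ Γ)
      (fun h hm hn hp => hΓ.mem_of_le_s3 h ⟨hm, hp, hn⟩)
      (fun h h' hw => by
        have := hinj h h' (by linear_combination hw)
        tauto)
      (fun x => by
        obtain ⟨m, n, p, hm, hx⟩ := hsurj x
        exact ⟨m, p, n, hm, by linear_combination hx⟩)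
      hi.1 hi.2 hk.1 hk.2 hj.1 hj.2 hv.2.1 hv.2.2.1 hv.2.2.2
      (fun m n q1 q2 q3 q4 => by simpa using huniq m n ⟨q1, q2, q3, q4⟩)
      (fun m n q1 q2 q3 => by
        by_contra q4
        exact hno m n ⟨q1, q2, q3, q4⟩)
    refine ⟨wtG_eq hΓ h1 ?_, wtG_eq hΓ h3 ?_⟩
    · rw [wtN_eq har, wtN_eq har]
      linear_combination -h2
    · rw [wtN_eq har, wtN_eq har]
      linear_combination -h4

end GH
end
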